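/- Let n be even with 4 ≤ n ≤ 8. In the multivariate polynomial ring ℚ[x_1, …, x_{n−1}], set q_{ij} = x_i + x_{i+1} + … + x_{j−1} for 1 ≤ i < j ≤ n, and let P be the n×n skew-symmetric matrix over this ring with, for i < j, P_{ij} = ∏ q_{ab}, the product over all pairs (a,b) with 1 ≤ a < b ≤ n, {a,b} ∩ {i,j} ≠ ∅ and (a,b) ≠ (i,j). Then every coefficient of the polynomial Pf P is nonnegative. -/

import Mathlib

open scoped BigOperators

/-- The Pfaffian of an `n × n` matrix over `MvPolynomial (Fin m) ℚ` (intended for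
skew-symmetric matrices with `n` even), given by the formula
`Pf A = (1/(2^k k!)) ∑_{σ ∈ S_{2k}} sgn(σ) ∏_{i=1}^k A_{σ(2i-1),σ(2i)}` with `k = n/2`. -/
noncomputable def PfPoly {n m : ℕ}
    (A : Matrix (Fin n) (Fin n) (MvPolynomial (Fin m) ℚ)) :
    MvPolynomial (Fin m) ℚ :=
  MvPolynomial.C (1 / (2 ^ (n / 2) * (Nat.factorial (n / 2)) : ℚ)) *
    ∑ σ : Equiv.Perm (Fin n), ((Equiv.Perm.sign σ : ℤ) : MvPolynomial (Fin m) ℚ) *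
      ∏ i : Fin (n / 2),
        A (σ ⟨2 * i.val, by have := i.isLt; omega⟩)
          (σ ⟨2 * i.val + 1, by have := i.isLt; omega⟩)


section
open Equiv
variable {R : Type*} [CommRing R]

def T4 (B : Fin 4 → Fin 4 → R) : R :=
  ∑ σ : Perm (Fin 4), ((Perm.sign σ : ℤ) : R) * (B (σ 0) (σ 1) * B (σ 2) (σ 3))
def T6 (B : Fin 6 → Fin 6 → R) : R :=
  ∑ σ : Perm (Fin 6), ((Perm.sign σ : ℤ) : R) * (B (σ 0) (σ 1) * B (σ 2) (σ 3) * B (σ 4) (σ 5))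
def T8 (B : Fin 8 → Fin 8 → R) : R :=
  ∑ σ : Perm (Fin 8), ((Perm.sign σ : ℤ) : R) *
    (B (σ 0) (σ 1) * B (σ 2) (σ 3) * B (σ 4) (σ 5) * B (σ 6) (σ 7))

def phi {n : ℕ} (p : Fin (n+2)) (r : Fin (n+1)) (x : Fin n) : Fin (n+2) :=
  swap 0 p (swap 0 r x.succ).succ

def sg {n : ℕ} (p : Fin (n+1)) : ℤ := if p = 0 then 1 else -1

lemma sum_perm {n : ℕ} (f : Perm (Fin (n+2)) → R) :
    ∑ σ, f σ = ∑ p : Fin (n+2), ∑ r : Fin (n+1), ∑ e : Perm (Fin n),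
      f (Perm.decomposeFin.symm (p, Perm.decomposeFin.symm (r, e))) := by
  rw [← Equiv.sum_comp Perm.decomposeFin.symm, Fintype.sum_prod_type]
  refine Finset.sum_congr rfl fun p _ => ?_
  rw [← Equiv.sum_comp Perm.decomposeFin.symm, Fintype.sum_prod_type]

lemma dec0 {n : ℕ} (p : Fin (n+2)) (r : Fin (n+1)) (e : Perm (Fin n)) :
    Perm.decomposeFin.symm (p, Perm.decomposeFin.symm (r, e)) 0 = p := by simp
lemma dec1 {n : ℕ} (p : Fin (n+2)) (r : Fin (n+1)) (e : Perm (Fin n)) :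
    Perm.decomposeFin.symm (p, Perm.decomposeFin.symm (r, e)) 1 = swap 0 p r.succ := by
  rw [← Fin.succ_zero_eq_one, Perm.decomposeFin_symm_apply_succ]; simp
lemma dec2 {n : ℕ} (p : Fin (n+2)) (r : Fin (n+1)) (e : Perm (Fin n)) (x : Fin n) :
    Perm.decomposeFin.symm (p, Perm.decomposeFin.symm (r, e)) x.succ.succ = phi p r (e x) := by
  rw [Perm.decomposeFin_symm_apply_succ, Perm.decomposeFin_symm_apply_succ]; rfl
lemma decs {n : ℕ} (p : Fin (n+2)) (r : Fin (n+1)) (e : Perm (Fin n)) :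
    ((Perm.sign (Perm.decomposeFin.symm (p, Perm.decomposeFin.symm (r, e))) : ℤ))
      = sg p * sg r * (Perm.sign e : ℤ) := by
  rw [Perm.decomposeFin.symm_sign, Perm.decomposeFin.symm_sign]
  unfold sg
  split_ifs <;> simp

lemma T6_step (B : Fin 6 → Fin 6 → R) : T6 B = ∑ p : Fin 6, ∑ r : Fin 5,
    ((sg p * sg r : ℤ) : R) * B p (swap 0 p r.succ) * T4 (fun i j => B (phi p r i) (phi p r j)) := by
  unfold T6 T4
  rw [sum_perm]
  refine Finset.sum_congr rfl fun p _ => Finset.sum_congr rfl fun r _ => ?_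
  rw [Finset.mul_sum]
  refine Finset.sum_congr rfl fun e _ => ?_
  rw [decs, dec0, dec1]
  have h2 := dec2 p r e 0
  have h3 := dec2 p r e 1
  have h4 := dec2 p r e 2
  have h5 := dec2 p r e 3
  change Perm.decomposeFin.symm (p, Perm.decomposeFin.symm (r, e)) 2 = _ at h2
  change Perm.decomposeFin.symm (p, Perm.decomposeFin.symm (r, e)) 3 = _ at h3
  change Perm.decomposeFin.symm (p, Perm.decomposeFin.symm (r, e)) 4 = _ at h4
  change Perm.decomposeFin.symm (p, Perm.decomposeFin.symm (r, e)) 5 = _ at h5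
  rw [h2, h3, h4, h5]
  push_cast
  ring

lemma T8_step (B : Fin 8 → Fin 8 → R) : T8 B = ∑ p : Fin 8, ∑ r : Fin 7,
    ((sg p * sg r : ℤ) : R) * B p (swap 0 p r.succ) * T6 (fun i j => B (phi p r i) (phi p r j)) := by
  unfold T8 T6
  rw [sum_perm]
  refine Finset.sum_congr rfl fun p _ => Finset.sum_congr rfl fun r _ => ?_
  rw [Finset.mul_sum]
  refine Finset.sum_congr rfl fun e _ => ?_
  rw [decs, dec0, dec1]
  have h2 := dec2 p r e 0
  have h3 := dec2 p r e 1
  have h4 := dec2 p r e 2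
  have h5 := dec2 p r e 3
  have h6 := dec2 p r e 4
  have h7 := dec2 p r e 5
  change Perm.decomposeFin.symm (p, Perm.decomposeFin.symm (r, e)) 2 = _ at h2
  change Perm.decomposeFin.symm (p, Perm.decomposeFin.symm (r, e)) 3 = _ at h3
  change Perm.decomposeFin.symm (p, Perm.decomposeFin.symm (r, e)) 4 = _ at h4
  change Perm.decomposeFin.symm (p, Perm.decomposeFin.symm (r, e)) 5 = _ at h5
  change Perm.decomposeFin.symm (p, Perm.decomposeFin.symm (r, e)) 6 = _ at h6
  change Perm.decomposeFin.symm (p, Perm.decomposeFin.symm (r, e)) 7 = _ at h7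
  rw [h2, h3, h4, h5, h6, h7]
  push_cast
  ring

lemma T4_step (B : Fin 4 → Fin 4 → R) : T4 B = ∑ p : Fin 4, ∑ r : Fin 3,
    ((sg p * sg r : ℤ) : R) * B p (swap 0 p r.succ) *
      (B (phi p r 0) (phi p r 1) - B (phi p r 1) (phi p r 0)) := by
  unfold T4
  rw [sum_perm]
  refine Finset.sum_congr rfl fun p _ => Finset.sum_congr rfl fun r _ => ?_
  have hp : (Finset.univ : Finset (Perm (Fin 2))) = {1, swap 0 1} := by decide
  rw [hp, Finset.sum_insert (by decide), Finset.sum_singleton]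
  simp only [decs, dec0, dec1]
  have h2 := fun e => dec2 p r e 0
  have h3 := fun e => dec2 p r e 1
  change ∀ e, Perm.decomposeFin.symm (p, Perm.decomposeFin.symm (r, e)) 2 = _ at h2
  change ∀ e, Perm.decomposeFin.symm (p, Perm.decomposeFin.symm (r, e)) 3 = _ at h3
  simp only [h2, h3, Perm.sign_one, Perm.sign_swap (show (0 : Fin 2) ≠ 1 by decide),
    Perm.one_apply, swap_apply_left, swap_apply_right]
  push_cast
  ring

def Q4 (B : Fin 4 → Fin 4 → R) : R := B 0 1 * B 2 3 - B 0 2 * B 1 3 + B 0 3 * B 1 2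

def Q6 (B : Fin 6 → Fin 6 → R) : R :=
    B 0 1 * B 2 3 * B 4 5 - B 0 1 * B 2 4 * B 3 5 + B 0 1 * B 2 5 * B 3 4 - B 0 2 * B 1 3 * B 4
    5 + B 0 2 * B 1 4 * B 3 5 - B 0 2 * B 1 5 * B 3 4 + B 0 3 * B 1 2 * B 4 5 - B 0 3 * B 1 4 *
    B 2 5 + B 0 3 * B 1 5 * B 2 4 - B 0 4 * B 1 2 * B 3 5 + B 0 4 * B 1 3 * B 2 5 - B 0 4 * B 1
    5 * B 2 3 + B 0 5 * B 1 2 * B 3 4 - B 0 5 * B 1 3 * B 2 4 + B 0 5 * B 1 4 * B 2 3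

def Q8 (B : Fin 8 → Fin 8 → R) : R :=
    B 0 1 * B 2 3 * B 4 5 * B 6 7 - B 0 1 * B 2 3 * B 4 6 * B 5 7 + B 0 1 * B 2 3 * B 4 7 * B 5
    6 - B 0 1 * B 2 4 * B 3 5 * B 6 7 + B 0 1 * B 2 4 * B 3 6 * B 5 7 - B 0 1 * B 2 4 * B 3 7 *
    B 5 6 + B 0 1 * B 2 5 * B 3 4 * B 6 7 - B 0 1 * B 2 5 * B 3 6 * B 4 7 + B 0 1 * B 2 5 * B 3
    7 * B 4 6 - B 0 1 * B 2 6 * B 3 4 * B 5 7 + B 0 1 * B 2 6 * B 3 5 * B 4 7 - B 0 1 * B 2 6 *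
    B 3 7 * B 4 5 + B 0 1 * B 2 7 * B 3 4 * B 5 6 - B 0 1 * B 2 7 * B 3 5 * B 4 6 + B 0 1 * B 2
    7 * B 3 6 * B 4 5 - B 0 2 * B 1 3 * B 4 5 * B 6 7 + B 0 2 * B 1 3 * B 4 6 * B 5 7 - B 0 2 *
    B 1 3 * B 4 7 * B 5 6 + B 0 2 * B 1 4 * B 3 5 * B 6 7 - B 0 2 * B 1 4 * B 3 6 * B 5 7 + B 0
    2 * B 1 4 * B 3 7 * B 5 6 - B 0 2 * B 1 5 * B 3 4 * B 6 7 + B 0 2 * B 1 5 * B 3 6 * B 4 7 -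
    B 0 2 * B 1 5 * B 3 7 * B 4 6 + B 0 2 * B 1 6 * B 3 4 * B 5 7 - B 0 2 * B 1 6 * B 3 5 * B 4
    7 + B 0 2 * B 1 6 * B 3 7 * B 4 5 - B 0 2 * B 1 7 * B 3 4 * B 5 6 + B 0 2 * B 1 7 * B 3 5 *
    B 4 6 - B 0 2 * B 1 7 * B 3 6 * B 4 5 + B 0 3 * B 1 2 * B 4 5 * B 6 7 - B 0 3 * B 1 2 * B 4
    6 * B 5 7 + B 0 3 * B 1 2 * B 4 7 * B 5 6 - B 0 3 * B 1 4 * B 2 5 * B 6 7 + B 0 3 * B 1 4 *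
    B 2 6 * B 5 7 - B 0 3 * B 1 4 * B 2 7 * B 5 6 + B 0 3 * B 1 5 * B 2 4 * B 6 7 - B 0 3 * B 1
    5 * B 2 6 * B 4 7 + B 0 3 * B 1 5 * B 2 7 * B 4 6 - B 0 3 * B 1 6 * B 2 4 * B 5 7 + B 0 3 *
    B 1 6 * B 2 5 * B 4 7 - B 0 3 * B 1 6 * B 2 7 * B 4 5 + B 0 3 * B 1 7 * B 2 4 * B 5 6 - B 0
    3 * B 1 7 * B 2 5 * B 4 6 + B 0 3 * B 1 7 * B 2 6 * B 4 5 - B 0 4 * B 1 2 * B 3 5 * B 6 7 +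
    B 0 4 * B 1 2 * B 3 6 * B 5 7 - B 0 4 * B 1 2 * B 3 7 * B 5 6 + B 0 4 * B 1 3 * B 2 5 * B 6
    7 - B 0 4 * B 1 3 * B 2 6 * B 5 7 + B 0 4 * B 1 3 * B 2 7 * B 5 6 - B 0 4 * B 1 5 * B 2 3 *
    B 6 7 + B 0 4 * B 1 5 * B 2 6 * B 3 7 - B 0 4 * B 1 5 * B 2 7 * B 3 6 + B 0 4 * B 1 6 * B 2
    3 * B 5 7 - B 0 4 * B 1 6 * B 2 5 * B 3 7 + B 0 4 * B 1 6 * B 2 7 * B 3 5 - B 0 4 * B 1 7 *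
    B 2 3 * B 5 6 + B 0 4 * B 1 7 * B 2 5 * B 3 6 - B 0 4 * B 1 7 * B 2 6 * B 3 5 + B 0 5 * B 1
    2 * B 3 4 * B 6 7 - B 0 5 * B 1 2 * B 3 6 * B 4 7 + B 0 5 * B 1 2 * B 3 7 * B 4 6 - B 0 5 *
    B 1 3 * B 2 4 * B 6 7 + B 0 5 * B 1 3 * B 2 6 * B 4 7 - B 0 5 * B 1 3 * B 2 7 * B 4 6 + B 0
    5 * B 1 4 * B 2 3 * B 6 7 - B 0 5 * B 1 4 * B 2 6 * B 3 7 + B 0 5 * B 1 4 * B 2 7 * B 3 6 -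
    B 0 5 * B 1 6 * B 2 3 * B 4 7 + B 0 5 * B 1 6 * B 2 4 * B 3 7 - B 0 5 * B 1 6 * B 2 7 * B 3
    4 + B 0 5 * B 1 7 * B 2 3 * B 4 6 - B 0 5 * B 1 7 * B 2 4 * B 3 6 + B 0 5 * B 1 7 * B 2 6 *
    B 3 4 - B 0 6 * B 1 2 * B 3 4 * B 5 7 + B 0 6 * B 1 2 * B 3 5 * B 4 7 - B 0 6 * B 1 2 * B 3
    7 * B 4 5 + B 0 6 * B 1 3 * B 2 4 * B 5 7 - B 0 6 * B 1 3 * B 2 5 * B 4 7 + B 0 6 * B 1 3 *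
    B 2 7 * B 4 5 - B 0 6 * B 1 4 * B 2 3 * B 5 7 + B 0 6 * B 1 4 * B 2 5 * B 3 7 - B 0 6 * B 1
    4 * B 2 7 * B 3 5 + B 0 6 * B 1 5 * B 2 3 * B 4 7 - B 0 6 * B 1 5 * B 2 4 * B 3 7 + B 0 6 *
    B 1 5 * B 2 7 * B 3 4 - B 0 6 * B 1 7 * B 2 3 * B 4 5 + B 0 6 * B 1 7 * B 2 4 * B 3 5 - B 0
    6 * B 1 7 * B 2 5 * B 3 4 + B 0 7 * B 1 2 * B 3 4 * B 5 6 - B 0 7 * B 1 2 * B 3 5 * B 4 6 +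
    B 0 7 * B 1 2 * B 3 6 * B 4 5 - B 0 7 * B 1 3 * B 2 4 * B 5 6 + B 0 7 * B 1 3 * B 2 5 * B 4
    6 - B 0 7 * B 1 3 * B 2 6 * B 4 5 + B 0 7 * B 1 4 * B 2 3 * B 5 6 - B 0 7 * B 1 4 * B 2 5 *
    B 3 6 + B 0 7 * B 1 4 * B 2 6 * B 3 5 - B 0 7 * B 1 5 * B 2 3 * B 4 6 + B 0 7 * B 1 5 * B 2
    4 * B 3 6 - B 0 7 * B 1 5 * B 2 6 * B 3 4 + B 0 7 * B 1 6 * B 2 3 * B 4 5 - B 0 7 * B 1 6 *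
    B 2 4 * B 3 5 + B 0 7 * B 1 6 * B 2 5 * B 3 4

lemma T4_eq (B : Fin 4 → Fin 4 → R) (hB : ∀ i j, B j i = - B i j) : T4 B = 8 * Q4 B := by
  rw [T4_step]
  simp only [Fin.sum_univ_succ, Fin.sum_univ_zero, Finset.univ_eq_empty, Finset.sum_empty, Fin.succ_zero_eq_one, Fin.reduceSucc]
  simp only [phi, sg, Fin.reduceSucc, swap_apply_def, Fin.reduceEq, if_true, if_false, Fin.succ_zero_eq_one, Fin.isValue, reduceIte, Fin.reduceFinMk]
  simp only [hB 0 1, hB 0 2, hB 0 3, hB 1 2, hB 1 3, hB 2 3]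
  unfold Q4
  push_cast
  ring

lemma T6_eq (B : Fin 6 → Fin 6 → R) (hB : ∀ i j, B j i = - B i j) : T6 B = 48 * Q6 B := by
  rw [T6_step]
  have hh : ∀ (p : Fin 6) (r : Fin 5), T4 (fun i j => B (phi p r i) (phi p r j)) = 8 * Q4 (fun i j => B (phi p r i) (phi p r j)) :=
    fun p r => T4_eq _ (fun i j => hB _ _)
  simp only [hh]
  simp only [Fin.sum_univ_succ, Fin.sum_univ_zero, Finset.univ_eq_empty, Finset.sum_empty, Fin.succ_zero_eq_one, Fin.reduceSucc]
  simp only [Q4, phi, sg, Fin.reduceSucc, swap_apply_def, Fin.reduceEq, if_true, if_false, Fin.succ_zero_eq_one, Fin.isValue, reduceIte, Fin.reduceFinMk]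
  simp only [hB 0 1, hB 0 2, hB 0 3, hB 0 4, hB 0 5, hB 1 2, hB 1 3, hB 1 4, hB 1 5, hB 2 3, hB
    2 4, hB 2 5, hB 3 4, hB 3 5, hB 4 5]
  unfold Q6
  push_cast
  ring

lemma T8_eq (B : Fin 8 → Fin 8 → R) (hB : ∀ i j, B j i = - B i j) : T8 B = 384 * Q8 B := by
  rw [T8_step]
  have hh : ∀ (p : Fin 8) (r : Fin 7), T6 (fun i j => B (phi p r i) (phi p r j)) = 48 * Q6 (fun i j => B (phi p r i) (phi p r j)) :=
    fun p r => T6_eq _ (fun i j => hB _ _)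
  simp only [hh]
  simp only [Fin.sum_univ_succ, Fin.sum_univ_zero, Finset.univ_eq_empty, Finset.sum_empty, Fin.succ_zero_eq_one, Fin.reduceSucc]
  simp only [Q6, phi, sg, Fin.reduceSucc, swap_apply_def, Fin.reduceEq, if_true, if_false, Fin.succ_zero_eq_one, Fin.isValue, reduceIte, Fin.reduceFinMk]
  simp only [hB 0 1, hB 0 2, hB 0 3, hB 0 4, hB 0 5, hB 0 6, hB 0 7, hB 1 2, hB 1 3, hB 1 4, hB
    1 5, hB 1 6, hB 1 7, hB 2 3, hB 2 4, hB 2 5, hB 2 6, hB 2 7, hB 3 4, hB 3 5, hB 3 6, hB 3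
    7, hB 4 5, hB 4 6, hB 4 7, hB 5 6, hB 5 7, hB 6 7]
  unfold Q8
  push_cast
  ring

end

section

/-- A polynomial all of whose coefficients are nonnegative. -/
def NN {m : ℕ} (p : MvPolynomial (Fin m) ℚ) : Prop := ∀ d, 0 ≤ MvPolynomial.coeff d p

namespace NN
variable {m : ℕ} {p q : MvPolynomial (Fin m) ℚ}

lemma zero : NN (0 : MvPolynomial (Fin m) ℚ) := fun d => by simp

lemma const {c : ℚ} (hc : 0 ≤ c) : NN (MvPolynomial.C c : MvPolynomial (Fin m) ℚ) := fun d => by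
  rw [MvPolynomial.coeff_C]; split_ifs <;> simp [hc]

lemma one : NN (1 : MvPolynomial (Fin m) ℚ) := by
  rw [← MvPolynomial.C_1]; exact const zero_le_one

lemma var (i : Fin m) : NN (MvPolynomial.X i : MvPolynomial (Fin m) ℚ) := fun d => by
  rw [MvPolynomial.coeff_X]; split_ifs <;> simp

lemma add (hp : NN p) (hq : NN q) : NN (p + q) := fun d => by
  rw [MvPolynomial.coeff_add]; exact add_nonneg (hp d) (hq d)

lemma mul (hp : NN p) (hq : NN q) : NN (p * q) := fun d => by
  rw [MvPolynomial.coeff_mul]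
  exact Finset.sum_nonneg fun x _ => mul_nonneg (hp _) (hq _)

lemma pow (hp : NN p) (k : ℕ) : NN (p ^ k) := by
  induction k with
  | zero => rw [pow_zero]; exact one
  | succ k ih => rw [pow_succ]; exact ih.mul hp

lemma intCast {c : ℤ} (hc : 0 ≤ c) : NN ((c : ℤ) : MvPolynomial (Fin m) ℚ) := by
  have h : ((c : ℤ) : MvPolynomial (Fin m) ℚ) = MvPolynomial.C (c : ℚ) := by simp
  rw [h]; exact const (by exact_mod_cast hc)

end NN

section checker
variable {R : Type*} [CommRing R]

/-- Value of the monomial with exponent list `m`. -/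
def evM : (ℕ → R) → List ℕ → R
  | _, [] => 1
  | v, e :: m => v 0 ^ e * evM (fun i => v (i + 1)) m

def getM : ℕ → List ℕ → ℕ
  | _, [] => 0
  | 0, e :: _ => e
  | i + 1, _ :: m => getM i m

def subM (t : ℕ) : ℕ → List ℕ → List ℕ
  | _, [] => []
  | 0, e :: m => (e - t) :: m
  | i + 1, e :: m => e :: subM t i m

def addM (t : ℕ) : ℕ → List ℕ → List ℕ
  | 0, [] => [t]
  | 0, e :: m => (e + t) :: m
  | i + 1, [] => 0 :: addM t i []
  | i + 1, e :: m => e :: addM t i m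

lemma evM_sub (t i : ℕ) (m : List ℕ) (v : ℕ → R) (h : t ≤ getM i m) :
    evM v m = evM v (subM t i m) * v i ^ t := by
  induction m generalizing i v with
  | nil => cases i <;> simp [getM] at h <;> subst h <;> simp [subM]
  | cons e m ih =>
    cases i with
    | zero =>
      simp only [getM] at h
      simp only [evM, subM]
      obtain ⟨s, rfl⟩ := Nat.exists_eq_add_of_le h
      rw [Nat.add_sub_cancel_left, pow_add]; ring
    | succ i =>
      simp only [getM] at h
      simp only [evM, subM]
      rw [ih i _ h]; ring

lemma evM_add (t i : ℕ) (m : List ℕ) (v : ℕ → R) :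
    evM v (addM t i m) = evM v m * v i ^ t := by
  induction i generalizing m v with
  | zero => cases m <;> simp [addM, evM, pow_add]; ring
  | succ i ih =>
    cases m with
    | nil => simp only [addM, evM, ih, pow_zero]; ring
    | cons e m => simp only [addM, evM, ih]; ring

/-- A three-term rule `x_i x_j = x_k x_l + x_p x_s`. -/
structure Rule where
  (i j k l p s : ℕ)

def Rule.Holds (r : Rule) (v : ℕ → R) : Prop :=
  v r.i * v r.j = v r.k * v r.l + v r.p * v r.s

abbrev FP := List (List ℕ × ℤ)

def evP (v : ℕ → R) : FP → R
  | [] => 0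
  | x :: L => (x.2 : R) * evM v x.1 + evP v L

lemma evP_append (v : ℕ → R) (L M : FP) : evP v (L ++ M) = evP v L + evP v M := by
  induction L with
  | nil => simp [evP]
  | cons x L ih => simp only [List.cons_append, evP, ih]; ring

/-- Expand `c * b * (x_k x_l + x_p x_s) ^ t`, restricted to the first `u` terms. -/
def expand (r : Rule) (b : List ℕ) (c : ℤ) (t : ℕ) : ℕ → FP
  | 0 => []
  | u + 1 => (addM u r.k (addM u r.l (addM (t - u) r.p (addM (t - u) r.s b))), c * (t.choose u : ℤ))
      :: expand r b c t u

lemma evP_expand (r : Rule) (b : List ℕ) (c : ℤ) (t u : ℕ) (v : ℕ → R) :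
    evP v (expand r b c t u) = (c : R) * evM v b *
      ∑ w ∈ Finset.range u, (v r.k * v r.l) ^ w * (v r.p * v r.s) ^ (t - w) * (t.choose w : R) := by
  induction u with
  | zero => simp [expand, evP]
  | succ u ih =>
    simp only [expand, evP, ih, Finset.sum_range_succ, evM_add]
    push_cast
    ring

def applyMono (r : Rule) (x : List ℕ × ℤ) : FP :=
  match min (getM r.i x.1) (getM r.j x.1) with
  | 0 => [x]
  | t + 1 => expand r (subM (t + 1) r.i (subM (t + 1) r.j x.1)) x.2 (t + 1) (t + 2)

lemma getM_sub_ne (t : ℕ) (i j : ℕ) (m : List ℕ) (h : i ≠ j) :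
    getM i (subM t j m) = getM i m := by
  induction m generalizing i j with
  | nil => cases j <;> rfl
  | cons e m ih =>
    cases i <;> cases j
    · exact absurd rfl h
    · rfl
    · rfl
    · simp only [subM, getM]; exact ih _ _ (by omega)

lemma evP_applyMono (r : Rule) (hij : r.i ≠ r.j) (x : List ℕ × ℤ) (v : ℕ → R) (hr : r.Holds v) :
    evP v (applyMono r x) = (x.2 : R) * evM v x.1 := by
  unfold applyMono
  split
  · simp [evP]
  · rename_i t ht
    rw [evP_expand, ← add_pow, ← show v r.i * v r.j = _ from hr]
    have h1 := evM_sub (t + 1) r.j x.1 v (by omega)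
    have h2 := evM_sub (t + 1) r.i (subM (t + 1) r.j x.1) v
      (by rw [getM_sub_ne _ _ _ _ hij]; omega)
    rw [h1, h2]
    ring

def applyRule (r : Rule) : FP → FP
  | [] => []
  | x :: L => applyMono r x ++ applyRule r L

lemma evP_applyRule (r : Rule) (hij : r.i ≠ r.j) (L : FP) (v : ℕ → R) (hr : r.Holds v) :
    evP v (applyRule r L) = evP v L := by
  induction L with
  | nil => rfl
  | cons x L ih => simp only [applyRule, evP_append, evP_applyMono r hij x v hr, ih, evP]

/-- Lexicographic comparison. -/
def cmpM : List ℕ → List ℕ → Ordering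
  | [], [] => .eq
  | [], _ :: _ => .lt
  | _ :: _, [] => .gt
  | a :: l, b :: m => bif Nat.beq a b then cmpM l m else bif Nat.ble a b then .lt else .gt

lemma cmpM_eq (l m : List ℕ) (h : cmpM l m = .eq) : l = m := by
  induction l generalizing m with
  | nil => cases m with
    | nil => rfl
    | cons b m => simp [cmpM] at h
  | cons a l ih => cases m with
    | nil => simp [cmpM] at h
    | cons b m =>
      simp only [cmpM] at h
      cases hb : Nat.beq a b with
      | true =>
        rw [hb] at h
        rw [Nat.eq_of_beq_eq_true hb, ih m h]
      | false =>
        rw [hb] at h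
        cases hc : Nat.ble a b <;> rw [hc] at h <;> simp at h

/-- Merge of two sorted formal polynomials. -/
def mergeP : ℕ → FP → FP → FP
  | 0, L, M => L ++ M
  | _ + 1, [], M => M
  | _ + 1, L, [] => L
  | n + 1, x :: L, y :: M =>
    match cmpM x.1 y.1 with
    | .lt => x :: mergeP n L (y :: M)
    | .gt => y :: mergeP n (x :: L) M
    | .eq => (x.1, x.2 + y.2) :: mergeP n L M

lemma evP_mergeP (n : ℕ) (L M : FP) (v : ℕ → R) : evP v (mergeP n L M) = evP v L + evP v M := by
  induction n generalizing L M with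
  | zero => exact evP_append v L M
  | succ n ih =>
    cases L with
    | nil => simp [mergeP, evP]
    | cons x L =>
      cases M with
      | nil => simp [mergeP, evP]
      | cons y M =>
        simp only [mergeP]
        split
        · simp only [evP, ih]; ring
        · simp only [evP, ih]; ring
        · rename_i h
          have := cmpM_eq _ _ h
          simp only [evP, ih, this]; push_cast; ring

def mergePairs : List FP → List FP
  | [] => []
  | [L] => [L]
  | L :: M :: Q => mergeP 100000 L M :: mergePairs Q

def evL (v : ℕ → R) : List FP → R
  | [] => 0
  | L :: Q => evP v L + evL v Q

lemma evL_mergePairs : ∀ (Q : List FP) (v : ℕ → R), evL v (mergePairs Q) = evL v Q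
  | [], v => rfl
  | [L], v => rfl
  | L :: M :: Q, v => by
    simp only [mergePairs, evL, evP_mergeP, evL_mergePairs Q v]; ring

def collapse : ℕ → List FP → FP
  | 0, Q => Q.flatten
  | _ + 1, [] => []
  | _ + 1, [L] => L
  | n + 1, L :: M :: Q => collapse n (mergePairs (L :: M :: Q))

lemma evP_flatten (Q : List FP) (v : ℕ → R) : evP v Q.flatten = evL v Q := by
  induction Q with
  | nil => rfl
  | cons L Q ih => simp only [List.flatten_cons, evP_append, evL, ih]

lemma evP_collapse (n : ℕ) (Q : List FP) (v : ℕ → R) : evP v (collapse n Q) = evL v Q := by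
  induction n generalizing Q with
  | zero => exact evP_flatten Q v
  | succ n ih =>
    match Q with
    | [] => rfl
    | [L] => simp [collapse, evL]
    | L :: M :: Q => simp only [collapse]; rw [ih, evL_mergePairs]

def singles : FP → List FP
  | [] => []
  | x :: L => [x] :: singles L

lemma evL_singles (L : FP) (v : ℕ → R) : evL v (singles L) = evP v L := by
  induction L with
  | nil => rfl
  | cons x L ih => simp only [singles, evL, evP, ih]; ring

def run : List Rule → FP → FP
  | [], L => L
  | r :: rs, L => run rs (collapse 40 (singles (applyRule r L)))

lemma evP_run (rs : List Rule) (L : FP) (v : ℕ → R)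
    (h : ∀ r ∈ rs, r.i ≠ r.j ∧ r.Holds v) : evP v (run rs L) = evP v L := by
  induction rs generalizing L with
  | nil => rfl
  | cons r rs ih =>
    simp only [run]
    rw [ih _ (fun r' hr' => h r' (List.mem_cons_of_mem _ hr')), evP_collapse, evL_singles,
      evP_applyRule r (h r List.mem_cons_self).1 L v (h r List.mem_cons_self).2]

def allNonneg : FP → Bool
  | [] => true
  | x :: L => match x.2 with
    | .ofNat _ => allNonneg L
    | .negSucc _ => false

end checker

lemma NN.evM {m : ℕ} (l : List ℕ) (v : ℕ → MvPolynomial (Fin m) ℚ) (hv : ∀ i, NN (v i)) :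
    NN (evM v l) := by
  induction l generalizing v with
  | nil => exact NN.one
  | cons e l ih => exact ((hv 0).pow e).mul (ih _ (fun i => hv (i + 1)))

lemma NN.evP {m : ℕ} (L : FP) (v : ℕ → MvPolynomial (Fin m) ℚ) (hv : ∀ i, NN (v i))
    (h : allNonneg L = true) : NN (evP v L) := by
  induction L with
  | nil => exact NN.zero
  | cons x L ih =>
    simp only [allNonneg] at h
    split at h
    · rename_i n hn
      refine NN.add (NN.mul (NN.intCast ?_) (NN.evM _ v hv)) (ih h)
      rw [hn]; exact Int.natCast_nonneg n
    · simp at h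

lemma NN.of_run {m : ℕ} (rs : List Rule) (L : FP) (v : ℕ → MvPolynomial (Fin m) ℚ)
    (hv : ∀ i, NN (v i)) (h : ∀ r ∈ rs, r.i ≠ r.j ∧ r.Holds v)
    (hc : allNonneg (run rs L) = true) : NN (_root_.evP v L) := by
  rw [← evP_run rs L v h]
  exact NN.evP _ v hv hc

/-- The fifteen three-term rules for six points (pairs numbered lexicographically). -/
def ruleTable : List Rule := [
  ⟨1, 6, 0, 9, 2, 5⟩,
  ⟨1, 7, 0, 10, 3, 5⟩,
  ⟨1, 8, 0, 11, 4, 5⟩,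
  ⟨2, 7, 0, 12, 3, 6⟩,
  ⟨2, 8, 0, 13, 4, 6⟩,
  ⟨3, 8, 0, 14, 4, 7⟩,
  ⟨2, 10, 1, 12, 3, 9⟩,
  ⟨2, 11, 1, 13, 4, 9⟩,
  ⟨3, 11, 1, 14, 4, 10⟩,
  ⟨3, 13, 2, 14, 4, 12⟩,
  ⟨6, 10, 5, 12, 7, 9⟩,
  ⟨6, 11, 5, 13, 8, 9⟩,
  ⟨7, 11, 5, 14, 8, 10⟩,
  ⟨7, 13, 6, 14, 8, 12⟩,
  ⟨10, 13, 9, 14, 11, 12⟩]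

def poly0 : FP := [
  ([0, 2, 2, 2, 2, 2, 2, 2, 2, 0, 2, 2, 2, 2, 0], 1),
  ([0, 2, 2, 2, 2, 2, 2, 2, 2, 2, 0, 2, 2, 0, 2], -1),
  ([0, 2, 2, 2, 2, 2, 2, 2, 2, 2, 2, 0, 0, 2, 2], 1),
  ([2, 0, 2, 2, 2, 2, 0, 2, 2, 2, 2, 2, 2, 2, 0], -1),
  ([2, 0, 2, 2, 2, 2, 2, 0, 2, 2, 2, 2, 2, 0, 2], 1),
  ([2, 0, 2, 2, 2, 2, 2, 2, 0, 2, 2, 2, 0, 2, 2], -1),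
  ([2, 2, 0, 2, 2, 0, 2, 2, 2, 2, 2, 2, 2, 2, 0], 1),
  ([2, 2, 0, 2, 2, 2, 2, 0, 2, 2, 2, 0, 2, 2, 2], -1),
  ([2, 2, 0, 2, 2, 2, 2, 2, 0, 2, 0, 2, 2, 2, 2], 1),
  ([2, 2, 2, 0, 2, 0, 2, 2, 2, 2, 2, 2, 2, 0, 2], -1),
  ([2, 2, 2, 0, 2, 2, 0, 2, 2, 2, 2, 0, 2, 2, 2], 1),
  ([2, 2, 2, 0, 2, 2, 2, 2, 0, 0, 2, 2, 2, 2, 2], -1),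
  ([2, 2, 2, 2, 0, 0, 2, 2, 2, 2, 2, 2, 0, 2, 2], 1),
  ([2, 2, 2, 2, 0, 2, 0, 2, 2, 2, 0, 2, 2, 2, 2], -1),
  ([2, 2, 2, 2, 0, 2, 2, 0, 2, 0, 2, 2, 2, 2, 2], 1)]

def seq0 : List Rule := [
  ⟨3, 8, 0, 14, 4, 7⟩,
  ⟨2, 7, 0, 12, 3, 6⟩,
  ⟨10, 13, 9, 14, 11, 12⟩,
  ⟨1, 8, 0, 11, 4, 5⟩,
  ⟨3, 11, 1, 14, 4, 10⟩,
  ⟨6, 10, 5, 12, 7, 9⟩,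
  ⟨6, 11, 5, 13, 8, 9⟩,
  ⟨7, 13, 6, 14, 8, 12⟩,
  ⟨1, 8, 0, 11, 4, 5⟩,
  ⟨1, 6, 0, 9, 2, 5⟩,
  ⟨2, 7, 0, 12, 3, 6⟩]

lemma check0 : allNonneg (run seq0 poly0) = true := by decide +kernel

def poly1 : FP := [
  ([0, 2, 2, 2, 2, 2, 2, 2, 2, 0, 2, 2, 2, 2, 0], 2),
  ([0, 2, 2, 2, 2, 2, 2, 2, 2, 2, 0, 2, 2, 0, 2], -4),
  ([0, 2, 2, 2, 2, 2, 2, 2, 2, 2, 2, 0, 0, 2, 2], 2),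
  ([2, 0, 2, 2, 2, 2, 0, 2, 2, 2, 2, 2, 2, 2, 0], -4),
  ([2, 0, 2, 2, 2, 2, 2, 0, 2, 2, 2, 2, 2, 0, 2], 6),
  ([2, 0, 2, 2, 2, 2, 2, 2, 0, 2, 2, 2, 0, 2, 2], -4),
  ([2, 2, 0, 2, 2, 0, 2, 2, 2, 2, 2, 2, 2, 2, 0], 2),
  ([2, 2, 0, 2, 2, 2, 2, 0, 2, 2, 2, 0, 2, 2, 2], -28),
  ([2, 2, 0, 2, 2, 2, 2, 2, 0, 2, 0, 2, 2, 2, 2], 8),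
  ([2, 2, 2, 0, 2, 0, 2, 2, 2, 2, 2, 2, 2, 0, 2], -4),
  ([2, 2, 2, 0, 2, 2, 0, 2, 2, 2, 2, 0, 2, 2, 2], 8),
  ([2, 2, 2, 0, 2, 2, 2, 2, 0, 0, 2, 2, 2, 2, 2], -4),
  ([2, 2, 2, 2, 0, 0, 2, 2, 2, 2, 2, 2, 0, 2, 2], 4),
  ([2, 2, 2, 2, 0, 2, 0, 2, 2, 2, 0, 2, 2, 2, 2], -8),
  ([2, 2, 2, 2, 0, 2, 2, 0, 2, 0, 2, 2, 2, 2, 2], 4)]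

def seq1 : List Rule := [
  ⟨6, 11, 5, 13, 8, 9⟩,
  ⟨2, 7, 0, 12, 3, 6⟩,
  ⟨1, 7, 0, 10, 3, 5⟩,
  ⟨2, 10, 1, 12, 3, 9⟩,
  ⟨1, 6, 0, 9, 2, 5⟩,
  ⟨1, 8, 0, 11, 4, 5⟩,
  ⟨2, 10, 1, 12, 3, 9⟩,
  ⟨2, 11, 1, 13, 4, 9⟩,
  ⟨1, 8, 0, 11, 4, 5⟩,
  ⟨10, 13, 9, 14, 11, 12⟩,
  ⟨6, 11, 5, 13, 8, 9⟩,
  ⟨3, 13, 2, 14, 4, 12⟩,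
  ⟨3, 8, 0, 14, 4, 7⟩,
  ⟨2, 7, 0, 12, 3, 6⟩,
  ⟨7, 11, 5, 14, 8, 10⟩,
  ⟨3, 8, 0, 14, 4, 7⟩,
  ⟨2, 11, 1, 13, 4, 9⟩]

lemma check1 : allNonneg (run seq1 poly1) = true := by decide +kernel

def poly2 : FP := [
  ([0, 2, 2, 2, 2, 2, 2, 2, 2, 2, 0, 2, 2, 0, 2], 2),
  ([2, 0, 2, 2, 2, 2, 2, 0, 2, 2, 2, 2, 2, 0, 2], -2),
  ([2, 2, 0, 2, 2, 2, 2, 0, 2, 2, 2, 0, 2, 2, 2], 6),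
  ([2, 2, 0, 2, 2, 2, 2, 2, 0, 2, 0, 2, 2, 2, 2], -4),
  ([2, 2, 2, 0, 2, 2, 0, 2, 2, 2, 2, 0, 2, 2, 2], -2),
  ([2, 2, 2, 2, 0, 2, 0, 2, 2, 2, 0, 2, 2, 2, 2], 2)]

def seq2 : List Rule := [
  ⟨2, 8, 0, 13, 4, 6⟩,
  ⟨3, 8, 0, 14, 4, 7⟩,
  ⟨1, 7, 0, 10, 3, 5⟩,
  ⟨3, 11, 1, 14, 4, 10⟩]

lemma check2 : allNonneg (run seq2 poly2) = true := by decide +kernel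

def poly3 : FP := [
  ([2, 0, 2, 2, 2, 2, 2, 0, 2, 2, 2, 2, 2, 0, 2], -7),
  ([2, 0, 2, 2, 2, 2, 2, 2, 0, 2, 2, 2, 0, 2, 2], 20),
  ([2, 2, 0, 2, 2, 2, 2, 0, 2, 2, 2, 0, 2, 2, 2], 6),
  ([2, 2, 0, 2, 2, 2, 2, 2, 0, 2, 0, 2, 2, 2, 2], -7),
  ([2, 2, 2, 0, 2, 0, 2, 2, 2, 2, 2, 2, 2, 0, 2], -2),
  ([2, 2, 2, 0, 2, 2, 0, 2, 2, 2, 2, 0, 2, 2, 2], 2),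
  ([2, 2, 2, 2, 0, 0, 2, 2, 2, 2, 2, 2, 0, 2, 2], 2),
  ([2, 2, 2, 2, 0, 2, 0, 2, 2, 2, 0, 2, 2, 2, 2], -2)]

def seq3 : List Rule := [
  ⟨3, 13, 2, 14, 4, 12⟩,
  ⟨10, 13, 9, 14, 11, 12⟩,
  ⟨3, 8, 0, 14, 4, 7⟩,
  ⟨2, 10, 1, 12, 3, 9⟩,
  ⟨1, 8, 0, 11, 4, 5⟩,
  ⟨1, 6, 0, 9, 2, 5⟩,
  ⟨2, 10, 1, 12, 3, 9⟩,
  ⟨1, 6, 0, 9, 2, 5⟩,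
  ⟨2, 7, 0, 12, 3, 6⟩]

lemma check3 : allNonneg (run seq3 poly3) = true := by decide +kernel

def poly4 : FP := [
  ([2, 2, 0, 2, 2, 2, 2, 0, 2, 2, 2, 0, 2, 2, 2], 1),
  ([2, 2, 0, 2, 2, 2, 2, 2, 0, 2, 0, 2, 2, 2, 2], -5),
  ([2, 2, 2, 0, 2, 2, 0, 2, 2, 2, 2, 0, 2, 2, 2], -5),
  ([2, 2, 2, 0, 2, 2, 2, 2, 0, 0, 2, 2, 2, 2, 2], 8),
  ([2, 2, 2, 2, 0, 2, 0, 2, 2, 2, 0, 2, 2, 2, 2], 8)]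

def seq4 : List Rule := [
  ⟨2, 10, 1, 12, 3, 9⟩,
  ⟨2, 11, 1, 13, 4, 9⟩,
  ⟨6, 11, 5, 13, 8, 9⟩]

lemma check4 : allNonneg (run seq4 poly4) = true := by decide +kernel


end

section

/-- Table lookup of variable values. -/
def vt {R : Type*} [Zero R] (L : List R) (i : ℕ) : R := L.getD i 0

/-- The hypotheses on six points: nonnegative brackets satisfying the three-term relations. -/
structure Good {m n : ℕ} (S : Fin n → Fin n → MvPolynomial (Fin m) ℚ) : Prop where
  symm : ∀ i j, S i j = S j i
  nn : ∀ i j, NN (S i j)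
  pl : ∀ a b c d, a < b → b < c → c < d → S a c * S b d = S a b * S c d + S a d * S b c

lemma vt_nn {m : ℕ} (L : List (MvPolynomial (Fin m) ℚ)) (h : ∀ x ∈ L, NN x) (i : ℕ) :
    NN (vt L i) := by
  unfold vt
  by_cases hi : i < L.length
  · rw [List.getD_eq_getElem _ _ hi]; exact h _ (List.getElem_mem hi)
  · rw [List.getD_eq_default _ _ (by omega)]; exact NN.zero

def tab {R : Type*} (S : Fin 6 → Fin 6 → R) : List R :=
  [S 0 1, S 0 2, S 0 3, S 0 4, S 0 5, S 1 2, S 1 3, S 1 4, S 1 5, S 2 3, S 2 4, S 2 5, S 3 4, S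
  3 5, S 4 5]

lemma Good.rules {m : ℕ} {S : Fin 6 → Fin 6 → MvPolynomial (Fin m) ℚ} (h : Good S) :
    ∀ r ∈ ruleTable, r.i ≠ r.j ∧ r.Holds (vt (tab S)) := by
  intro r hr
  simp only [ruleTable, List.mem_cons, List.not_mem_nil, or_false] at hr
  rcases hr with rfl | rfl | rfl | rfl | rfl | rfl | rfl | rfl | rfl | rfl | rfl | rfl | rfl | rfl | rfl
  · exact ⟨by decide, h.pl 0 1 2 3 (by decide) (by decide) (by decide)⟩
  · exact ⟨by decide, h.pl 0 1 2 4 (by decide) (by decide) (by decide)⟩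
  · exact ⟨by decide, h.pl 0 1 2 5 (by decide) (by decide) (by decide)⟩
  · exact ⟨by decide, h.pl 0 1 3 4 (by decide) (by decide) (by decide)⟩
  · exact ⟨by decide, h.pl 0 1 3 5 (by decide) (by decide) (by decide)⟩
  · exact ⟨by decide, h.pl 0 1 4 5 (by decide) (by decide) (by decide)⟩
  · exact ⟨by decide, h.pl 0 2 3 4 (by decide) (by decide) (by decide)⟩
  · exact ⟨by decide, h.pl 0 2 3 5 (by decide) (by decide) (by decide)⟩
  · exact ⟨by decide, h.pl 0 2 4 5 (by decide) (by decide) (by decide)⟩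
  · exact ⟨by decide, h.pl 0 3 4 5 (by decide) (by decide) (by decide)⟩
  · exact ⟨by decide, h.pl 1 2 3 4 (by decide) (by decide) (by decide)⟩
  · exact ⟨by decide, h.pl 1 2 3 5 (by decide) (by decide) (by decide)⟩
  · exact ⟨by decide, h.pl 1 2 4 5 (by decide) (by decide) (by decide)⟩
  · exact ⟨by decide, h.pl 1 3 4 5 (by decide) (by decide) (by decide)⟩
  · exact ⟨by decide, h.pl 2 3 4 5 (by decide) (by decide) (by decide)⟩

lemma evM_vt_nil {R : Type*} [CommRing R] (v : ℕ → R) : evM v [] = 1 := rfl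

lemma evM_vt_cons {R : Type*} [CommRing R] (x : R) (L : List R) (e : ℕ) (m : List ℕ) :
    evM (vt (x :: L)) (e :: m) = x ^ e * evM (vt L) m := rfl

lemma evP_nil' {R : Type*} [CommRing R] (v : ℕ → R) : evP v [] = 0 := rfl

lemma evP_cons' {R : Type*} [CommRing R] (v : ℕ → R) (m : List ℕ) (c : ℤ) (L : FP) :
    evP v ((m, c) :: L) = (c : R) * evM v m + evP v L := rfl

lemma tab_nn {m : ℕ} {S : Fin 6 → Fin 6 → MvPolynomial (Fin m) ℚ} (h : Good S) (i : ℕ) :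
    NN (vt (tab S) i) := by
  refine vt_nn _ ?_ i
  intro x hx
  simp only [tab, List.mem_cons, List.not_mem_nil, or_false] at hx
  rcases hx with rfl | rfl | rfl | rfl | rfl | rfl | rfl | rfl | rfl | rfl | rfl | rfl | rfl | rfl | rfl <;> exact h.nn _ _

lemma sub0 : seq0 ⊆ ruleTable := by
  intro r hr
  simp only [seq0, List.mem_cons, List.not_mem_nil, or_false] at hr
  simp only [ruleTable, List.mem_cons, List.not_mem_nil, or_false]
  tauto

lemma sub1 : seq1 ⊆ ruleTable := by
  intro r hr
  simp only [seq1, List.mem_cons, List.not_mem_nil, or_false] at hr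
  simp only [ruleTable, List.mem_cons, List.not_mem_nil, or_false]
  tauto

lemma sub2 : seq2 ⊆ ruleTable := by
  intro r hr
  simp only [seq2, List.mem_cons, List.not_mem_nil, or_false] at hr
  simp only [ruleTable, List.mem_cons, List.not_mem_nil, or_false]
  tauto

lemma sub3 : seq3 ⊆ ruleTable := by
  intro r hr
  simp only [seq3, List.mem_cons, List.not_mem_nil, or_false] at hr
  simp only [ruleTable, List.mem_cons, List.not_mem_nil, or_false]
  tauto

lemma sub4 : seq4 ⊆ ruleTable := by
  intro r hr
  simp only [seq4, List.mem_cons, List.not_mem_nil, or_false] at hr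
  simp only [ruleTable, List.mem_cons, List.not_mem_nil, or_false]
  tauto

def E0 {R : Type*} [CommRing R] (S : Fin 6 → Fin 6 → R) : R := evP (vt (tab S)) poly0

lemma E0_nn {m : ℕ} {S : Fin 6 → Fin 6 → MvPolynomial (Fin m) ℚ} (h : Good S) : NN (E0 S) :=
  NN.of_run seq0 poly0 (vt (tab S)) (tab_nn h) (fun r hr => h.rules r (sub0 hr)) check0

def E1 {R : Type*} [CommRing R] (S : Fin 6 → Fin 6 → R) : R := evP (vt (tab S)) poly1

lemma E1_nn {m : ℕ} {S : Fin 6 → Fin 6 → MvPolynomial (Fin m) ℚ} (h : Good S) : NN (E1 S) :=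
  NN.of_run seq1 poly1 (vt (tab S)) (tab_nn h) (fun r hr => h.rules r (sub1 hr)) check1

def E2 {R : Type*} [CommRing R] (S : Fin 6 → Fin 6 → R) : R := evP (vt (tab S)) poly2

lemma E2_nn {m : ℕ} {S : Fin 6 → Fin 6 → MvPolynomial (Fin m) ℚ} (h : Good S) : NN (E2 S) :=
  NN.of_run seq2 poly2 (vt (tab S)) (tab_nn h) (fun r hr => h.rules r (sub2 hr)) check2

def E3 {R : Type*} [CommRing R] (S : Fin 6 → Fin 6 → R) : R := evP (vt (tab S)) poly3

lemma E3_nn {m : ℕ} {S : Fin 6 → Fin 6 → MvPolynomial (Fin m) ℚ} (h : Good S) : NN (E3 S) :=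
  NN.of_run seq3 poly3 (vt (tab S)) (tab_nn h) (fun r hr => h.rules r (sub3 hr)) check3

def E4 {R : Type*} [CommRing R] (S : Fin 6 → Fin 6 → R) : R := evP (vt (tab S)) poly4

lemma E4_nn {m : ℕ} {S : Fin 6 → Fin 6 → MvPolynomial (Fin m) ℚ} (h : Good S) : NN (E4 S) :=
  NN.of_run seq4 poly4 (vt (tab S)) (tab_nn h) (fun r hr => h.rules r (sub4 hr)) check4

lemma Good.comp {m n k : ℕ} {S : Fin n → Fin n → MvPolynomial (Fin m) ℚ} (h : Good S)
    (f : Fin k → Fin n) (hf : StrictMono f) : Good (fun i j => S (f i) (f j)) where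
  symm i j := h.symm _ _
  nn i j := h.nn _ _
  pl a b c d h1 h2 h3 := h.pl _ _ _ _ (hf h1) (hf h2) (hf h3)

/-- Cyclic rotation. -/
def rot {R : Type*} (S : Fin 8 → Fin 8 → R) (i j : Fin 8) : R := S (i + 1) (j + 1)

lemma Good.rot {m : ℕ} {S : Fin 8 → Fin 8 → MvPolynomial (Fin m) ℚ} (h : Good S) :
    Good (rot S) where
  symm i j := h.symm _ _
  nn i j := h.nn _ _
  pl a b c d h1 h2 h3 := by
    unfold _root_.rot
    by_cases hd : d = 7
    · subst hd
      have := h.pl (7 + 1) (a + 1) (b + 1) (c + 1) (by lia) (by lia) (by lia)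
      rw [h.symm (b + 1) (7 + 1), h.symm (c + 1) (7 + 1), h.symm (a + 1) (7 + 1)]
      linear_combination this
    · exact h.pl _ _ _ _ (by lia) (by lia) (by lia)

def emb1 : Fin 6 → Fin 8 := ![2, 3, 4, 5, 6, 7]

def H1 {R : Type*} [CommRing R] (S : Fin 8 → Fin 8 → R) : R :=
    (S 0 2 ^ 2 * S 0 3 ^ 2 * S 0 4 ^ 2 * S 0 5 ^ 2 * S 0 6 ^ 2 * S 0 7 ^ 2 * S 1 2 ^ 2 * S 1 3
    ^ 2 * S 1 4 ^ 2 * S 1 5 ^ 2 * S 1 6 ^ 2 * S 1 7 ^ 2) * E1 (fun i j => S (emb1 i) (emb1 j))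

lemma H1_nn {m : ℕ} {S : Fin 8 → Fin 8 → MvPolynomial (Fin m) ℚ} (h : Good S) : NN (H1 S) := by
  unfold H1
  refine NN.mul ?_ (E1_nn (h.comp emb1 (by unfold StrictMono emb1; decide)))
  have n := fun i j => (h.nn i j).pow 2
  exact (((((((((((n _ _).mul (n _ _)).mul (n _ _)).mul (n _ _)).mul (n _ _)).mul (n _ _)).mul (n _ _)).mul (n _ _)).mul (n _ _)).mul (n _ _)).mul (n _ _)).mul (n _ _)

def emb2 : Fin 6 → Fin 8 := ![1, 3, 4, 5, 6, 7]

def H2 {R : Type*} [CommRing R] (S : Fin 8 → Fin 8 → R) : R :=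
    (S 0 1 ^ 2 * S 0 3 ^ 2 * S 0 4 ^ 2 * S 0 5 ^ 2 * S 0 6 ^ 2 * S 0 7 ^ 2 * S 1 2 ^ 2 * S 2 3
    ^ 2 * S 2 4 ^ 2 * S 2 5 ^ 2 * S 2 6 ^ 2 * S 2 7 ^ 2) * E2 (fun i j => S (emb2 i) (emb2 j))

lemma H2_nn {m : ℕ} {S : Fin 8 → Fin 8 → MvPolynomial (Fin m) ℚ} (h : Good S) : NN (H2 S) := by
  unfold H2
  refine NN.mul ?_ (E2_nn (h.comp emb2 (by unfold StrictMono emb2; decide)))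
  have n := fun i j => (h.nn i j).pow 2
  exact (((((((((((n _ _).mul (n _ _)).mul (n _ _)).mul (n _ _)).mul (n _ _)).mul (n _ _)).mul (n _ _)).mul (n _ _)).mul (n _ _)).mul (n _ _)).mul (n _ _)).mul (n _ _)

def emb3 : Fin 6 → Fin 8 := ![1, 2, 4, 5, 6, 7]

def H3 {R : Type*} [CommRing R] (S : Fin 8 → Fin 8 → R) : R :=
    (S 0 1 ^ 2 * S 0 2 ^ 2 * S 0 4 ^ 2 * S 0 5 ^ 2 * S 0 6 ^ 2 * S 0 7 ^ 2 * S 1 3 ^ 2 * S 2 3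
    ^ 2 * S 3 4 ^ 2 * S 3 5 ^ 2 * S 3 6 ^ 2 * S 3 7 ^ 2) * E3 (fun i j => S (emb3 i) (emb3 j))

lemma H3_nn {m : ℕ} {S : Fin 8 → Fin 8 → MvPolynomial (Fin m) ℚ} (h : Good S) : NN (H3 S) := by
  unfold H3
  refine NN.mul ?_ (E3_nn (h.comp emb3 (by unfold StrictMono emb3; decide)))
  have n := fun i j => (h.nn i j).pow 2
  exact (((((((((((n _ _).mul (n _ _)).mul (n _ _)).mul (n _ _)).mul (n _ _)).mul (n _ _)).mul (n _ _)).mul (n _ _)).mul (n _ _)).mul (n _ _)).mul (n _ _)).mul (n _ _)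

def emb4 : Fin 6 → Fin 8 := ![1, 2, 3, 5, 6, 7]

def H4 {R : Type*} [CommRing R] (S : Fin 8 → Fin 8 → R) : R :=
    (S 0 1 ^ 2 * S 0 2 ^ 2 * S 0 3 ^ 2 * S 0 5 ^ 2 * S 0 6 ^ 2 * S 0 7 ^ 2 * S 1 4 ^ 2 * S 2 4
    ^ 2 * S 3 4 ^ 2 * S 4 5 ^ 2 * S 4 6 ^ 2 * S 4 7 ^ 2) * E4 (fun i j => S (emb4 i) (emb4 j))

lemma H4_nn {m : ℕ} {S : Fin 8 → Fin 8 → MvPolynomial (Fin m) ℚ} (h : Good S) : NN (H4 S) := by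
  unfold H4
  refine NN.mul ?_ (E4_nn (h.comp emb4 (by unfold StrictMono emb4; decide)))
  have n := fun i j => (h.nn i j).pow 2
  exact (((((((((((n _ _).mul (n _ _)).mul (n _ _)).mul (n _ _)).mul (n _ _)).mul (n _ _)).mul (n _ _)).mul (n _ _)).mul (n _ _)).mul (n _ _)).mul (n _ _)).mul (n _ _)

def HH {R : Type*} [CommRing R] (S : Fin 8 → Fin 8 → R) : R := H1 S + H2 S + H3 S + H4 S

lemma HH_nn {m : ℕ} {S : Fin 8 → Fin 8 → MvPolynomial (Fin m) ℚ} (h : Good S) : NN (HH S) :=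
  (((H1_nn h).add (H2_nn h)).add (H3_nn h)).add (H4_nn h)

/-- `P` is given by the product formula in terms of the brackets `S`. -/
def IsP4 {R : Type*} [CommRing R] (S P : Fin 4 → Fin 4 → R) : Prop :=
  P 0 1 = S 0 2 * S 0 3 * S 1 2 * S 1 3 ∧ P 0 2 = S 0 1 * S 0 3 * S 1 2 * S 2 3 ∧ P 0 3 = S 0 1
  * S 0 2 * S 1 3 * S 2 3 ∧ P 1 2 = S 0 1 * S 0 2 * S 1 3 * S 2 3 ∧ P 1 3 = S 0 1 * S 0 3 * S 1
  2 * S 2 3 ∧ P 2 3 = S 0 2 * S 0 3 * S 1 2 * S 1 3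

/-- `P` is given by the product formula in terms of the brackets `S`. -/
def IsP6 {R : Type*} [CommRing R] (S P : Fin 6 → Fin 6 → R) : Prop :=
  P 0 1 = S 0 2 * S 0 3 * S 0 4 * S 0 5 * S 1 2 * S 1 3 * S 1 4 * S 1 5 ∧ P 0 2 = S 0 1 * S 0 3
  * S 0 4 * S 0 5 * S 1 2 * S 2 3 * S 2 4 * S 2 5 ∧ P 0 3 = S 0 1 * S 0 2 * S 0 4 * S 0 5 * S 1
  3 * S 2 3 * S 3 4 * S 3 5 ∧ P 0 4 = S 0 1 * S 0 2 * S 0 3 * S 0 5 * S 1 4 * S 2 4 * S 3 4 * S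
  4 5 ∧ P 0 5 = S 0 1 * S 0 2 * S 0 3 * S 0 4 * S 1 5 * S 2 5 * S 3 5 * S 4 5 ∧ P 1 2 = S 0 1 *
  S 0 2 * S 1 3 * S 1 4 * S 1 5 * S 2 3 * S 2 4 * S 2 5 ∧ P 1 3 = S 0 1 * S 0 3 * S 1 2 * S 1 4
  * S 1 5 * S 2 3 * S 3 4 * S 3 5 ∧ P 1 4 = S 0 1 * S 0 4 * S 1 2 * S 1 3 * S 1 5 * S 2 4 * S 3
  4 * S 4 5 ∧ P 1 5 = S 0 1 * S 0 5 * S 1 2 * S 1 3 * S 1 4 * S 2 5 * S 3 5 * S 4 5 ∧ P 2 3 = S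
  0 2 * S 0 3 * S 1 2 * S 1 3 * S 2 4 * S 2 5 * S 3 4 * S 3 5 ∧ P 2 4 = S 0 2 * S 0 4 * S 1 2 *
  S 1 4 * S 2 3 * S 2 5 * S 3 4 * S 4 5 ∧ P 2 5 = S 0 2 * S 0 5 * S 1 2 * S 1 5 * S 2 3 * S 2 4
  * S 3 5 * S 4 5 ∧ P 3 4 = S 0 3 * S 0 4 * S 1 3 * S 1 4 * S 2 3 * S 2 4 * S 3 5 * S 4 5 ∧ P 3
  5 = S 0 3 * S 0 5 * S 1 3 * S 1 5 * S 2 3 * S 2 5 * S 3 4 * S 4 5 ∧ P 4 5 = S 0 4 * S 0 5 * S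
  1 4 * S 1 5 * S 2 4 * S 2 5 * S 3 4 * S 3 5

/-- `P` is given by the product formula in terms of the brackets `S`. -/
def IsP8 {R : Type*} [CommRing R] (S P : Fin 8 → Fin 8 → R) : Prop :=
  P 0 1 = S 0 2 * S 0 3 * S 0 4 * S 0 5 * S 0 6 * S 0 7 * S 1 2 * S 1 3 * S 1 4 * S 1 5 * S 1 6
  * S 1 7 ∧ P 0 2 = S 0 1 * S 0 3 * S 0 4 * S 0 5 * S 0 6 * S 0 7 * S 1 2 * S 2 3 * S 2 4 * S 2
  5 * S 2 6 * S 2 7 ∧ P 0 3 = S 0 1 * S 0 2 * S 0 4 * S 0 5 * S 0 6 * S 0 7 * S 1 3 * S 2 3 * S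
  3 4 * S 3 5 * S 3 6 * S 3 7 ∧ P 0 4 = S 0 1 * S 0 2 * S 0 3 * S 0 5 * S 0 6 * S 0 7 * S 1 4 *
  S 2 4 * S 3 4 * S 4 5 * S 4 6 * S 4 7 ∧ P 0 5 = S 0 1 * S 0 2 * S 0 3 * S 0 4 * S 0 6 * S 0 7
  * S 1 5 * S 2 5 * S 3 5 * S 4 5 * S 5 6 * S 5 7 ∧ P 0 6 = S 0 1 * S 0 2 * S 0 3 * S 0 4 * S 0
  5 * S 0 7 * S 1 6 * S 2 6 * S 3 6 * S 4 6 * S 5 6 * S 6 7 ∧ P 0 7 = S 0 1 * S 0 2 * S 0 3 * S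
  0 4 * S 0 5 * S 0 6 * S 1 7 * S 2 7 * S 3 7 * S 4 7 * S 5 7 * S 6 7 ∧ P 1 2 = S 0 1 * S 0 2 *
  S 1 3 * S 1 4 * S 1 5 * S 1 6 * S 1 7 * S 2 3 * S 2 4 * S 2 5 * S 2 6 * S 2 7 ∧ P 1 3 = S 0 1
  * S 0 3 * S 1 2 * S 1 4 * S 1 5 * S 1 6 * S 1 7 * S 2 3 * S 3 4 * S 3 5 * S 3 6 * S 3 7 ∧ P 1
  4 = S 0 1 * S 0 4 * S 1 2 * S 1 3 * S 1 5 * S 1 6 * S 1 7 * S 2 4 * S 3 4 * S 4 5 * S 4 6 * S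
  4 7 ∧ P 1 5 = S 0 1 * S 0 5 * S 1 2 * S 1 3 * S 1 4 * S 1 6 * S 1 7 * S 2 5 * S 3 5 * S 4 5 *
  S 5 6 * S 5 7 ∧ P 1 6 = S 0 1 * S 0 6 * S 1 2 * S 1 3 * S 1 4 * S 1 5 * S 1 7 * S 2 6 * S 3 6
  * S 4 6 * S 5 6 * S 6 7 ∧ P 1 7 = S 0 1 * S 0 7 * S 1 2 * S 1 3 * S 1 4 * S 1 5 * S 1 6 * S 2
  7 * S 3 7 * S 4 7 * S 5 7 * S 6 7 ∧ P 2 3 = S 0 2 * S 0 3 * S 1 2 * S 1 3 * S 2 4 * S 2 5 * S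
  2 6 * S 2 7 * S 3 4 * S 3 5 * S 3 6 * S 3 7 ∧ P 2 4 = S 0 2 * S 0 4 * S 1 2 * S 1 4 * S 2 3 *
  S 2 5 * S 2 6 * S 2 7 * S 3 4 * S 4 5 * S 4 6 * S 4 7 ∧ P 2 5 = S 0 2 * S 0 5 * S 1 2 * S 1 5
  * S 2 3 * S 2 4 * S 2 6 * S 2 7 * S 3 5 * S 4 5 * S 5 6 * S 5 7 ∧ P 2 6 = S 0 2 * S 0 6 * S 1
  2 * S 1 6 * S 2 3 * S 2 4 * S 2 5 * S 2 7 * S 3 6 * S 4 6 * S 5 6 * S 6 7 ∧ P 2 7 = S 0 2 * S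
  0 7 * S 1 2 * S 1 7 * S 2 3 * S 2 4 * S 2 5 * S 2 6 * S 3 7 * S 4 7 * S 5 7 * S 6 7 ∧ P 3 4 =
  S 0 3 * S 0 4 * S 1 3 * S 1 4 * S 2 3 * S 2 4 * S 3 5 * S 3 6 * S 3 7 * S 4 5 * S 4 6 * S 4 7
  ∧ P 3 5 = S 0 3 * S 0 5 * S 1 3 * S 1 5 * S 2 3 * S 2 5 * S 3 4 * S 3 6 * S 3 7 * S 4 5 * S 5
  6 * S 5 7 ∧ P 3 6 = S 0 3 * S 0 6 * S 1 3 * S 1 6 * S 2 3 * S 2 6 * S 3 4 * S 3 5 * S 3 7 * S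
  4 6 * S 5 6 * S 6 7 ∧ P 3 7 = S 0 3 * S 0 7 * S 1 3 * S 1 7 * S 2 3 * S 2 7 * S 3 4 * S 3 5 *
  S 3 6 * S 4 7 * S 5 7 * S 6 7 ∧ P 4 5 = S 0 4 * S 0 5 * S 1 4 * S 1 5 * S 2 4 * S 2 5 * S 3 4
  * S 3 5 * S 4 6 * S 4 7 * S 5 6 * S 5 7 ∧ P 4 6 = S 0 4 * S 0 6 * S 1 4 * S 1 6 * S 2 4 * S 2
  6 * S 3 4 * S 3 6 * S 4 5 * S 4 7 * S 5 6 * S 6 7 ∧ P 4 7 = S 0 4 * S 0 7 * S 1 4 * S 1 7 * S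
  2 4 * S 2 7 * S 3 4 * S 3 7 * S 4 5 * S 4 6 * S 5 7 * S 6 7 ∧ P 5 6 = S 0 5 * S 0 6 * S 1 5 *
  S 1 6 * S 2 5 * S 2 6 * S 3 5 * S 3 6 * S 4 5 * S 4 6 * S 5 7 * S 6 7 ∧ P 5 7 = S 0 5 * S 0 7
  * S 1 5 * S 1 7 * S 2 5 * S 2 7 * S 3 5 * S 3 7 * S 4 5 * S 4 7 * S 5 6 * S 6 7 ∧ P 6 7 = S 0
  6 * S 0 7 * S 1 6 * S 1 7 * S 2 6 * S 2 7 * S 3 6 * S 3 7 * S 4 6 * S 4 7 * S 5 6 * S 5 7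

set_option maxHeartbeats 20000000 in
lemma key8 {R : Type*} [CommRing R] (S P : Fin 8 → Fin 8 → R) (hs : ∀ i j, S i j = S j i)
    (hP : IsP8 S P) :
    8 * Q8 P = HH S + HH (rot S) + HH (rot (rot S)) + HH (rot (rot (rot S)))
      + HH (rot (rot (rot (rot S)))) + HH (rot (rot (rot (rot (rot S)))))
      + HH (rot (rot (rot (rot (rot (rot S)))))) + HH (rot (rot (rot (rot (rot (rot (rot S))))))) := by
  obtain ⟨h01, h02, h03, h04, h05, h06, h07, h12, h13, h14, h15, h16, h17, h23, h24, h25, h26, h27,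
    h34, h35, h36, h37, h45, h46, h47, h56, h57, h67⟩ := hP
  simp only [Q8, HH, H1, H2, H3, H4, E1, E2, E3, E4, poly1, poly2, poly3, poly4, evP_nil', evP_cons', evM_vt_nil, evM_vt_cons, tab, pow_zero, one_mul, mul_one, add_zero]
  simp only [emb1, emb2, emb3, emb4, rot]
  simp only [Matrix.cons_val, Fin.isValue, Fin.reduceAdd]
  simp only [hs 1 0, hs 2 0, hs 3 0, hs 4 0, hs 5 0, hs 6 0, hs 7 0, hs 2 1, hs 3 1, hs 4 1, hs
  5 1, hs 6 1, hs 7 1, hs 3 2, hs 4 2, hs 5 2, hs 6 2, hs 7 2, hs 4 3, hs 5 3, hs 6 3, hs 7 3,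
  hs 5 4, hs 6 4, hs 7 4, hs 6 5, hs 7 5, hs 7 6]
  simp only [h01, h02, h03, h04, h05, h06, h07, h12, h13, h14, h15, h16, h17, h23, h24, h25,
  h26, h27, h34, h35, h36, h37, h45, h46, h47, h56, h57, h67]
  push_cast
  ring

lemma key6 {R : Type*} [CommRing R] (S P : Fin 6 → Fin 6 → R) (hP : IsP6 S P) : Q6 P = E0 S := by
  obtain ⟨h01, h02, h03, h04, h05, h12, h13, h14, h15, h23, h24, h25, h34, h35, h45⟩ := hP
  simp only [Q6, E0, poly0, evP_nil', evP_cons', evM_vt_nil, evM_vt_cons, tab, pow_zero, one_mul, mul_one, add_zero, h01, h02, h03, h04, h05, h12, h13, h14, h15, h23, h24, h25, h34, h35, h45]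
  push_cast
  ring

lemma key4 {m : ℕ} (S P : Fin 4 → Fin 4 → MvPolynomial (Fin m) ℚ) (h : Good S)
    (hP : IsP4 S P) : NN (Q4 P) := by
  obtain ⟨h01, h02, h03, h12, h13, h23⟩ := hP
  have hpl := h.pl 0 1 2 3 (by decide) (by decide) (by decide)
  have e : Q4 P = (S 0 3 * S 1 2) ^ 2 * (S 0 2 * S 1 3) ^ 2
      + ((S 0 1 * S 2 3) ^ 3 * (S 0 2 * S 1 3) + (S 0 1 * S 2 3) ^ 3 * (S 0 3 * S 1 2)) := by
    simp only [Q4, h01, h02, h03, h12, h13, h23]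
    linear_combination (S 0 1 * S 2 3) ^ 2 * (S 0 2 * S 1 3 + S 0 3 * S 1 2) * hpl
  rw [e]
  have n := fun i j => h.nn i j
  exact ((((n _ _).mul (n _ _)).pow 2).mul (((n _ _).mul (n _ _)).pow 2)).add
    (((((n _ _).mul (n _ _)).pow 3).mul ((n _ _).mul (n _ _))).add
      ((((n _ _).mul (n _ _)).pow 3).mul ((n _ _).mul (n _ _))))

end

section

/-- The symmetrized brackets. -/
noncomputable def brk {n : ℕ} (q : Fin n → Fin n → MvPolynomial (Fin (n - 1)) ℚ)
    (i j : Fin n) : MvPolynomial (Fin (n - 1)) ℚ :=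
  if i < j then q i j else q j i

lemma NN.sum {m : ℕ} {ι : Type*} (s : Finset ι) (f : ι → MvPolynomial (Fin m) ℚ)
    (h : ∀ i ∈ s, NN (f i)) : NN (∑ i ∈ s, f i) := fun d => by
  rw [MvPolynomial.coeff_sum]
  exact Finset.sum_nonneg fun i hi => h i hi d

lemma brk_good {n : ℕ} (qij : Fin n → Fin n → MvPolynomial (Fin (n - 1)) ℚ)
    (hqij : ∀ i j : Fin n, qij i j =
      ∑ a : Fin (n - 1),
        if (i : ℕ) ≤ (a : ℕ) ∧ (a : ℕ) < (j : ℕ) then MvPolynomial.X a else 0) :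
    Good (brk qij) := by
  have hadd : ∀ a b c : Fin n, a < b → b < c → qij a c = qij a b + qij b c := by
    intro a b c hab hbc
    rw [hqij, hqij, hqij, ← Finset.sum_add_distrib]
    refine Finset.sum_congr rfl fun x _ => ?_
    have h1 : (a : ℕ) < b := hab
    have h2 : (b : ℕ) < c := hbc
    by_cases h : (x : ℕ) < b
    · have e1 : ((a : ℕ) ≤ x ∧ (x : ℕ) < c) ↔ ((a : ℕ) ≤ x ∧ (x : ℕ) < b) := by omega
      have e2 : ¬ ((b : ℕ) ≤ x ∧ (x : ℕ) < c) := by omega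
      simp only [e1, if_neg e2, add_zero]
    · have e1 : ((a : ℕ) ≤ x ∧ (x : ℕ) < c) ↔ ((b : ℕ) ≤ x ∧ (x : ℕ) < c) := by omega
      have e2 : ¬ ((a : ℕ) ≤ x ∧ (x : ℕ) < b) := by omega
      simp only [e1, if_neg e2, zero_add]
  have hnn : ∀ a b, NN (qij a b) := by
    intro a b
    rw [hqij]
    refine NN.sum _ _ fun x _ => ?_
    split_ifs
    · exact NN.var x
    · exact NN.zero
  refine ⟨?_, ?_, ?_⟩
  · intro i j
    unfold brk
    rcases lt_trichotomy i j with h | h | h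
    · rw [if_pos h, if_neg h.asymm]
    · subst h; rfl
    · rw [if_pos h, if_neg h.asymm]
  · intro i j
    unfold brk
    split_ifs
    · exact hnn _ _
    · exact hnn _ _
  · intro a b c d hab hbc hcd
    unfold brk
    rw [if_pos (hab.trans hbc), if_pos (hbc.trans hcd), if_pos hab, if_pos hcd,
      if_pos ((hab.trans hbc).trans hcd), if_pos hbc, hadd a b c hab hbc, hadd b c d hbc hcd,
      hadd a c d (hab.trans hbc) hcd, hadd a b c hab hbc]
    ring

lemma isP4 (qij : Fin 4 → Fin 4 → MvPolynomial (Fin 3) ℚ)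
    (P : Matrix (Fin 4) (Fin 4) (MvPolynomial (Fin 3) ℚ))
    (hP : ∀ i j : Fin 4, i < j → P i j =
      ∏ a : Fin 4, ∏ b : Fin 4,
        if a < b ∧ (a = i ∨ a = j ∨ b = i ∨ b = j) ∧ ¬(a = i ∧ b = j)
        then qij a b else 1) : IsP4 (brk (n := 4) qij) P := by
  unfold IsP4
  refine ⟨?_, ?_, ?_, ?_, ?_, ?_⟩ <;>
  · rw [hP _ _ (by decide)]
    simp only [Fin.prod_univ_four]
    simp only [brk, Fin.isValue, Fin.reduceLT, Fin.reduceEq, if_true, if_false, true_and, and_true,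
      false_and, and_false, true_or, or_true, or_false, false_or, not_true_eq_false,
      not_false_eq_true, mul_one, one_mul, lt_self_iff_false]
    try ring

lemma pf4 (P : Matrix (Fin 4) (Fin 4) (MvPolynomial (Fin 3) ℚ))
    (hPskew : ∀ i j, P j i = -P i j) : PfPoly P = Q4 P := by
  have h := T4_eq P hPskew
  have e : PfPoly P = MvPolynomial.C (1 / 8 : ℚ) * T4 P := by
    have hc : (1 / (2 ^ (4 / 2) * (Nat.factorial (4 / 2)) : ℚ)) = 1 / 8 := by
      norm_num [Nat.factorial]
    unfold PfPoly T4
    rw [hc]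
    refine congrArg (fun z => MvPolynomial.C (1 / 8 : ℚ) * z) ?_
    refine Finset.sum_congr rfl fun σ _ => ?_
    refine congrArg (fun z => ((Equiv.Perm.sign σ : ℤ) : MvPolynomial (Fin 3) ℚ) * z) ?_
    exact Fin.prod_univ_two _
  rw [e, h, ← mul_assoc]
  have h8 : (8 : MvPolynomial (Fin 3) ℚ) = MvPolynomial.C (8 : ℚ) :=
    (map_ofNat MvPolynomial.C 8).symm
  rw [h8, ← MvPolynomial.C_mul]
  norm_num

lemma isP6 (qij : Fin 6 → Fin 6 → MvPolynomial (Fin 5) ℚ)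
    (P : Matrix (Fin 6) (Fin 6) (MvPolynomial (Fin 5) ℚ))
    (hP : ∀ i j : Fin 6, i < j → P i j =
      ∏ a : Fin 6, ∏ b : Fin 6,
        if a < b ∧ (a = i ∨ a = j ∨ b = i ∨ b = j) ∧ ¬(a = i ∧ b = j)
        then qij a b else 1) : IsP6 (brk (n := 6) qij) P := by
  unfold IsP6
  refine ⟨?_, ?_, ?_, ?_, ?_, ?_, ?_, ?_, ?_, ?_, ?_, ?_, ?_, ?_, ?_⟩ <;>
  · rw [hP _ _ (by decide)]
    simp only [Fin.prod_univ_six]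
    simp only [brk, Fin.isValue, Fin.reduceLT, Fin.reduceEq, if_true, if_false, true_and, and_true,
      false_and, and_false, true_or, or_true, or_false, false_or, not_true_eq_false,
      not_false_eq_true, mul_one, one_mul, lt_self_iff_false]
    try ring

lemma pf6 (P : Matrix (Fin 6) (Fin 6) (MvPolynomial (Fin 5) ℚ))
    (hPskew : ∀ i j, P j i = -P i j) : PfPoly P = Q6 P := by
  have h := T6_eq P hPskew
  have e : PfPoly P = MvPolynomial.C (1 / 48 : ℚ) * T6 P := by
    have hc : (1 / (2 ^ (6 / 2) * (Nat.factorial (6 / 2)) : ℚ)) = 1 / 48 := by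
      norm_num [Nat.factorial]
    unfold PfPoly T6
    rw [hc]
    refine congrArg (fun z => MvPolynomial.C (1 / 48 : ℚ) * z) ?_
    refine Finset.sum_congr rfl fun σ _ => ?_
    refine congrArg (fun z => ((Equiv.Perm.sign σ : ℤ) : MvPolynomial (Fin 5) ℚ) * z) ?_
    exact Fin.prod_univ_three _
  rw [e, h, ← mul_assoc]
  have h48 : (48 : MvPolynomial (Fin 5) ℚ) = MvPolynomial.C (48 : ℚ) :=
    (map_ofNat MvPolynomial.C 48).symm
  rw [h48, ← MvPolynomial.C_mul]
  norm_num

lemma isP8 (qij : Fin 8 → Fin 8 → MvPolynomial (Fin 7) ℚ)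
    (P : Matrix (Fin 8) (Fin 8) (MvPolynomial (Fin 7) ℚ))
    (hP : ∀ i j : Fin 8, i < j → P i j =
      ∏ a : Fin 8, ∏ b : Fin 8,
        if a < b ∧ (a = i ∨ a = j ∨ b = i ∨ b = j) ∧ ¬(a = i ∧ b = j)
        then qij a b else 1) : IsP8 (brk (n := 8) qij) P := by
  unfold IsP8
  refine ⟨?_, ?_, ?_, ?_, ?_, ?_, ?_, ?_, ?_, ?_, ?_, ?_, ?_, ?_, ?_, ?_, ?_, ?_, ?_, ?_, ?_, ?_, ?_, ?_, ?_, ?_, ?_, ?_⟩ <;>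
  · rw [hP _ _ (by decide)]
    simp only [Fin.prod_univ_eight]
    simp only [brk, Fin.isValue, Fin.reduceLT, Fin.reduceEq, if_true, if_false, true_and, and_true,
      false_and, and_false, true_or, or_true, or_false, false_or, not_true_eq_false,
      not_false_eq_true, mul_one, one_mul, lt_self_iff_false]
    try ring

lemma pf8 (P : Matrix (Fin 8) (Fin 8) (MvPolynomial (Fin 7) ℚ))
    (hPskew : ∀ i j, P j i = -P i j) : PfPoly P = Q8 P := by
  have h := T8_eq P hPskew
  have e : PfPoly P = MvPolynomial.C (1 / 384 : ℚ) * T8 P := by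
    have hc : (1 / (2 ^ (8 / 2) * (Nat.factorial (8 / 2)) : ℚ)) = 1 / 384 := by
      norm_num [Nat.factorial]
    unfold PfPoly T8
    rw [hc]
    refine congrArg (fun z => MvPolynomial.C (1 / 384 : ℚ) * z) ?_
    refine Finset.sum_congr rfl fun σ _ => ?_
    refine congrArg (fun z => ((Equiv.Perm.sign σ : ℤ) : MvPolynomial (Fin 7) ℚ) * z) ?_
    exact Fin.prod_univ_four _
  rw [e, h, ← mul_assoc]
  have h384 : (384 : MvPolynomial (Fin 7) ℚ) = MvPolynomial.C (384 : ℚ) :=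
    (map_ofNat MvPolynomial.C 384).symm
  rw [h384, ← MvPolynomial.C_mul]
  norm_num

end

/-- for even n with 4 ≤ n ≤ 8, all coefficients of the Pfaffian of the
polynomial matrix `P` (with `q_{ij} = x_i + ⋯ + x_{j-1}` and `P_{ij}` the product of all
`q_{ab}` with `a < b`, `{a,b} ∩ {i,j} ≠ ∅`, `(a,b) ≠ (i,j)`) are nonnegative. -/
theorem stmt11 (n : ℕ) (hn : 4 ≤ n) (hn8 : n ≤ 8) (hne : Even n)
    (qij : Fin n → Fin n → MvPolynomial (Fin (n - 1)) ℚ)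
    (hqij : ∀ i j : Fin n, qij i j =
      ∑ a : Fin (n - 1),
        if (i : ℕ) ≤ (a : ℕ) ∧ (a : ℕ) < (j : ℕ) then MvPolynomial.X a else 0)
    (P : Matrix (Fin n) (Fin n) (MvPolynomial (Fin (n - 1)) ℚ))
    (hPskew : ∀ i j, P j i = -P i j)
    (hP : ∀ i j : Fin n, i < j → P i j =
      ∏ a : Fin n, ∏ b : Fin n,
        if a < b ∧ (a = i ∨ a = j ∨ b = i ∨ b = j) ∧ ¬(a = i ∧ b = j)
        then qij a b else 1) :
    ∀ m : Fin (n - 1) →₀ ℕ, 0 ≤ MvPolynomial.coeff m (PfPoly P) := by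
  have hg := brk_good qij hqij
  have hcases : n = 4 ∨ n = 6 ∨ n = 8 := by
    obtain ⟨k, hk⟩ := hne
    omega
  clear hqij
  rcases hcases with rfl | rfl | rfl
  · have h := key4 _ P hg (isP4 qij P hP)
    have e := pf4 P hPskew
    intro m
    rw [e]
    exact h m
  · have h := E0_nn hg
    rw [← key6 _ P (isP6 qij P hP)] at h
    have e := pf6 P hPskew
    intro m
    rw [e]
    exact h m
  · have h := key8 _ P hg.symm (isP8 qij P hP)
    have hr1 := hg.rot
    have hr2 := hr1.rot
    have hr3 := hr2.rot
    have hr4 := hr3.rot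
    have hr5 := hr4.rot
    have hr6 := hr5.rot
    have hr7 := hr6.rot
    have h8 := (((((((HH_nn hg).add (HH_nn hr1)).add (HH_nn hr2)).add (HH_nn hr3)).add
      (HH_nn hr4)).add (HH_nn hr5)).add (HH_nn hr6)).add (HH_nn hr7)
    rw [← h] at h8
    have e := pf8 P hPskew
    intro m
    rw [e]
    have h9 := h8 m
    have h10 : (8 : MvPolynomial (Fin (8 - 1)) ℚ) = MvPolynomial.C (8 : ℚ) :=
      (map_ofNat MvPolynomial.C 8).symm
    rw [h10, MvPolynomial.coeff_C_mul] at h9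
    linarith
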